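/- Every generalized Cahen–Wallach spacetime CW^d_r(A) of order r is a proper r-th symmetric Lorentzian manifold: its Riemann curvature tensor satisfies ∇^r R = 0 and ∇^{r-1} R ≠ 0. -/

import Mathlib

/-!
Core framework: coordinate tensor calculus on `ℝⁿ` (partial derivatives, Christoffel
symbols, Riemann curvature, iterated covariant derivatives `∇ʳR`), and a notion of
pseudo-Riemannian manifold given by an atlas of metric charts whose transition
functions are smooth isometries.
-/

noncomputable section

open Matrix Set

/-- Partial derivative in the `i`-th coordinate direction. -/
def pd {n : ℕ} (i : Fin n) (f : (Fin n → ℝ) → ℝ) (x : Fin n → ℝ) : ℝ :=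
  fderiv ℝ f x (Pi.single i 1)

/-- A metric in coordinates: a matrix-valued function on (an open subset of) `ℝⁿ`. -/
abbrev MetricMat (n : ℕ) := (Fin n → ℝ) → Matrix (Fin n) (Fin n) ℝ

/-- Christoffel symbols `Γ^k_{ij}` of a coordinate metric. -/
def christoffel {n : ℕ} (g : MetricMat n) (x : Fin n → ℝ) (k i j : Fin n) : ℝ :=
  (1 / 2) * ∑ l, (g x)⁻¹ k l *
    (pd i (fun y => g y l j) x + pd j (fun y => g y l i) x - pd l (fun y => g y i j) x)

/-- Curvature tensor `R^l_{kij}` (1,3) of a coordinate metric. -/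
def curvUp {n : ℕ} (g : MetricMat n) (x : Fin n → ℝ) (l k i j : Fin n) : ℝ :=
  pd i (fun y => christoffel g y l j k) x - pd j (fun y => christoffel g y l i k) x
    + ∑ m, christoffel g x l i m * christoffel g x m j k
    - ∑ m, christoffel g x l j m * christoffel g x m i k

/-- Covariant tensor fields of valence `s` in coordinates. -/
abbrev TensorField (n s : ℕ) := (Fin n → ℝ) → (Fin s → Fin n) → ℝ

/-- The (0,4) Riemann curvature tensor `R_{lkij} = g_{lm} R^m_{kij}`. -/
def riemann {n : ℕ} (g : MetricMat n) : TensorField n 4 := fun x idx =>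
  ∑ m, g x (idx 0) m * curvUp g x m (idx 1) (idx 2) (idx 3)

/-- The Ricci tensor `R_{ij} = R^m_{imj}`. -/
def ricci {n : ℕ} (g : MetricMat n) (x : Fin n → ℝ) (i j : Fin n) : ℝ :=
  ∑ m, curvUp g x m i m j

/-- Covariant derivative of a covariant tensor field; the new (derivative) index is slot `0`. -/
def covDeriv {n s : ℕ} (g : MetricMat n) (T : TensorField n s) : TensorField n (s + 1) :=
  fun x idx =>
    pd (idx 0) (fun y => T y fun a => idx a.succ) x
      - ∑ a : Fin s, ∑ e, christoffel g x e (idx 0) (idx a.succ)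
          * T x (Function.update (fun b : Fin s => idx b.succ) a e)

/-- Iterated covariant derivative `∇ʳ R` of the curvature tensor. -/
def nablaR {n : ℕ} (g : MetricMat n) : (r : ℕ) → TensorField n (4 + r)
  | 0 => riemann g
  | r + 1 => covDeriv g (nablaR g r)

/-- `∇ʳ R = 0` on `U` (`r`-th symmetry in coordinates). -/
def RthSymmetricOn {n : ℕ} (g : MetricMat n) (U : Set (Fin n → ℝ)) (r : ℕ) : Prop :=
  ∀ x ∈ U, ∀ idx, nablaR g r x idx = 0

/-- Vanishing curvature (flatness) on `U`. -/
def FlatOn {n : ℕ} (g : MetricMat n) (U : Set (Fin n → ℝ)) : Prop :=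
  ∀ x ∈ U, ∀ idx, riemann g x idx = 0

/-- A symmetric matrix is of Lorentzian signature `(-,+,…,+)` iff it is congruent to
`diag(-1,1,…,1)`. -/
def IsLorentzMat {n : ℕ} (A : Matrix (Fin n) (Fin n) ℝ) : Prop :=
  ∃ P : Matrix (Fin n) (Fin n) ℝ, IsUnit P.det ∧
    Pᵀ * A * P = Matrix.diagonal fun i : Fin n => if (i : ℕ) = 0 then (-1 : ℝ) else 1

/-- `τ` is smooth on `S` and pulls the metric `g₂` back to the metric `g₁` there. -/
def IsPullbackIsometry {n m : ℕ} (g₁ : MetricMat n) (g₂ : MetricMat m)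
    (τ : (Fin n → ℝ) → Fin m → ℝ) (S : Set (Fin n → ℝ)) : Prop :=
  (∀ a : Fin m, ContDiffOn ℝ (⊤ : ℕ∞) (fun y => τ y a) S) ∧
  ∀ x ∈ S, ∀ i j : Fin n,
    g₁ x i j = ∑ a, ∑ b, g₂ (τ x) a b * pd i (fun y => τ y a) x * pd j (fun y => τ y b) x

/-- A metric chart on a topological space `M`: a homeomorphism of an open set of `M` onto
an open set of `ℝⁿ`, together with the coordinate expression of the metric tensor. -/
structure MetricChart (n : ℕ) (M : Type) [TopologicalSpace M] where
  dom : Set M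
  open_dom : IsOpen dom
  φ : M → Fin n → ℝ
  ψ : (Fin n → ℝ) → M
  ran : Set (Fin n → ℝ)
  open_ran : IsOpen ran
  maps_to : ∀ p ∈ dom, φ p ∈ ran
  maps_from : ∀ x ∈ ran, ψ x ∈ dom
  left_inv : ∀ p ∈ dom, ψ (φ p) = p
  right_inv : ∀ x ∈ ran, φ (ψ x) = x
  cont_phi : ContinuousOn φ dom
  cont_psi : ContinuousOn ψ ran
  g : MetricMat n
  smooth_g : ∀ a b : Fin n, ContDiffOn ℝ (⊤ : ℕ∞) (fun x => g x a b) ran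
  symm_g : ∀ x ∈ ran, (g x).IsSymm
  nondeg_g : ∀ x ∈ ran, IsUnit (g x).det

/-- An `n`-dimensional pseudo-Riemannian manifold: a topological space covered by metric
charts whose transition functions are (smooth) isometries for the chart metrics. -/
structure PRManifold (n : ℕ) where
  M : Type
  top : TopologicalSpace M
  chartAt : M → @MetricChart n M top
  mem_chart : ∀ p : M, p ∈ (chartAt p).dom
  compatible : ∀ p q : M,
    IsPullbackIsometry (chartAt p).g (chartAt q).g ((chartAt q).φ ∘ (chartAt p).ψ)
      ((chartAt p).φ '' ((chartAt p).dom ∩ (chartAt q).dom))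

attribute [instance] PRManifold.top

namespace PRManifold

variable {n : ℕ}

/-- The metric is Lorentzian, of signature `(-,+,…,+)`. -/
def IsLorentzian (X : PRManifold n) : Prop :=
  ∀ p : X.M, ∀ x ∈ (X.chartAt p).ran, IsLorentzMat ((X.chartAt p).g x)

/-- The metric is Riemannian (positive definite). -/
def IsRiemannian (X : PRManifold n) : Prop :=
  ∀ p : X.M, ∀ x ∈ (X.chartAt p).ran, ((X.chartAt p).g x).PosDef

/-- Connectedness of the underlying space. -/
def Conn (X : PRManifold n) : Prop := ConnectedSpace X.M

/-- Simple connectedness of the underlying space. -/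
def SimplyConn (X : PRManifold n) : Prop := SimplyConnectedSpace X.M

/-- `∇ʳ R = 0` (in every chart). -/
def RthSymmetric (X : PRManifold n) (r : ℕ) : Prop :=
  ∀ p : X.M, RthSymmetricOn (X.chartAt p).g (X.chartAt p).ran r

/-- `∇ʳ R = 0` but `∇^{r-1} R ≠ 0`. -/
def ProperRthSymmetric (X : PRManifold n) (r : ℕ) : Prop :=
  X.RthSymmetric r ∧ ¬ X.RthSymmetric (r - 1)

/-- The curvature tensor vanishes identically. -/
def Flat (X : PRManifold n) : Prop :=
  ∀ p : X.M, FlatOn (X.chartAt p).g (X.chartAt p).ran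

/-- The Ricci tensor vanishes identically. -/
def RicciFlat (X : PRManifold n) : Prop :=
  ∀ p : X.M, ∀ x ∈ (X.chartAt p).ran, ∀ i j, ricci (X.chartAt p).g x i j = 0

end PRManifold

/-- A curve `c` (written in coordinates) is a geodesic of `g` on the parameter set `I`:
its components are twice differentiable and satisfy the geodesic equations. -/
def IsGeodesicCurve {n : ℕ} (g : MetricMat n) (I : Set ℝ) (c : ℝ → Fin n → ℝ) : Prop :=
  ∀ t ∈ I, ∀ k : Fin n,
    DifferentiableAt ℝ (fun s => c s k) t ∧
    DifferentiableAt ℝ (deriv fun s => c s k) t ∧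
    deriv (deriv fun s => c s k) t
      + ∑ i, ∑ j, christoffel g (c t) k i j * deriv (fun s => c s i) t
          * deriv (fun s => c s j) t = 0

namespace PRManifold

variable {n : ℕ}

/-- `γ` is a geodesic of `X` on the parameter set `I`: around each parameter it lies in a
chart and its coordinate expression solves the geodesic equations there. -/
def IsGeodesic (X : PRManifold n) (I : Set ℝ) (γ : ℝ → X.M) : Prop :=
  ∀ t ∈ I, ∃ p : X.M, ∃ ε > (0 : ℝ),
    (∀ s ∈ I ∩ Set.Ioo (t - ε) (t + ε), γ s ∈ (X.chartAt p).dom) ∧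
    IsGeodesicCurve (X.chartAt p).g (I ∩ Set.Ioo (t - ε) (t + ε))
      (fun s => (X.chartAt p).φ (γ s))

/-- Geodesic completeness: every (nontrivial) geodesic defined on an open interval
extends to a geodesic defined on all of `ℝ`. -/
def GeodesicallyComplete (X : PRManifold n) : Prop :=
  ∀ (a b : ℝ) (γ : ℝ → X.M), (Set.Ioo a b).Nonempty → X.IsGeodesic (Set.Ioo a b) γ →
    ∃ γ' : ℝ → X.M, X.IsGeodesic Set.univ γ' ∧ ∀ t ∈ Set.Ioo a b, γ' t = γ t

end PRManifold

/-- First block of coordinates of a product. -/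
def split1 {n₁ n₂ : ℕ} (x : Fin (n₁ + n₂) → ℝ) : Fin n₁ → ℝ := fun i => x (Fin.castAdd n₂ i)

/-- Second block of coordinates of a product. -/
def split2 {n₁ n₂ : ℕ} (x : Fin (n₁ + n₂) → ℝ) : Fin n₂ → ℝ := fun j => x (Fin.natAdd n₁ j)

/-- The direct-product (block diagonal) metric `g₁ ⊕ g₂` in coordinates. -/
def prodMetricMat {n₁ n₂ : ℕ} (G₁ : MetricMat n₁) (G₂ : MetricMat n₂) :
    MetricMat (n₁ + n₂) := fun x =>
  (Matrix.fromBlocks (G₁ (split1 x)) 0 0 (G₂ (split2 x))).submatrix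
    finSumFinEquiv.symm finSumFinEquiv.symm

/-- The (generalized Cahen–Wallach / plane-wave) metric
`g = -2du(dv + P_{ij}(u)xⁱxʲ du) + δ_{ij} dxⁱ dxʲ` on `ℝ^{e+2}`,
with coordinates `x 0 = u`, `x 1 = v` and spatial coordinates `x i.succ.succ`. -/
def cwMetric (e : ℕ) (P : ℝ → Matrix (Fin e) (Fin e) ℝ) : MetricMat (e + 2) := fun x k l =>
  (if k = 0 ∧ l = 0 then (-2) * ∑ i, ∑ j, P (x 0) i j * x i.succ.succ * x j.succ.succ else 0)
  + (if (k = 0 ∧ l = 1) ∨ (k = 1 ∧ l = 0) then -1 else 0)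
  + (if k = l ∧ 2 ≤ (k : ℕ) then 1 else 0)

/-- The Brinkmann metric `ds² = -2du(dv + H du + Wᵢ dxⁱ) + g_{ij} dxⁱ dxʲ` on `ℝ^{d+2}`,
with coordinates `x 0 = u`, `x 1 = v` and spatial coordinates `x i.succ.succ`. -/
def brinkmannMat (d : ℕ) (H : (Fin (d + 2) → ℝ) → ℝ) (W : Fin d → (Fin (d + 2) → ℝ) → ℝ)
    (gs : (Fin (d + 2) → ℝ) → Matrix (Fin d) (Fin d) ℝ) : MetricMat (d + 2) := fun x k l =>
  (if k = 0 ∧ l = 0 then (-2) * H x else 0)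
  + (if (k = 0 ∧ l = 1) ∨ (k = 1 ∧ l = 0) then -1 else 0)
  + (if k = 0 then ∑ i : Fin d, if l = i.succ.succ then -(W i x) else 0 else 0)
  + (if l = 0 then ∑ i : Fin d, if k = i.succ.succ then -(W i x) else 0 else 0)
  + ∑ i : Fin d, ∑ j : Fin d, if k = i.succ.succ ∧ l = j.succ.succ then gs x i j else 0

/-- A function on `ℝ^{d+2}` is independent of the coordinate `v = x 1`. -/
def vIndep {d : ℕ} {α : Type*} (f : (Fin (d + 2) → ℝ) → α) : Prop :=
  ∀ x t, f (Function.update x (1 : Fin (d + 2)) t) = f x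

/-- The point of `ℝ^{d+2}` with `u`, `v` and spatial coordinates `u`, `v`, `y`. -/
def emb (d : ℕ) (u v : ℝ) (y : Fin d → ℝ) : Fin (d + 2) → ℝ :=
  Fin.cons u (Fin.cons v y)
-- extension layer (appended to core for testing)
namespace PRManifold

variable {n : ℕ}

/-- A self-map of `Y` is a (global) isometry: it is a homeomorphism and, read in the
charts, it pulls the metric back to the metric. -/
def IsAutoIsometry (Y : PRManifold n) (σ : Y.M → Y.M) : Prop :=
  Function.Bijective σ ∧ Continuous σ ∧
    ∀ q : Y.M, ∃ S, IsOpen S ∧ (Y.chartAt q).φ q ∈ S ∧ S ⊆ (Y.chartAt q).ran ∧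
      (∀ x ∈ S, σ ((Y.chartAt q).ψ x) ∈ (Y.chartAt (σ q)).dom) ∧
      IsPullbackIsometry (Y.chartAt q).g (Y.chartAt (σ q)).g
        (fun x => (Y.chartAt (σ q)).φ (σ ((Y.chartAt q).ψ x))) S

/-- `Y` is a (globally) symmetric space: the geodesic symmetry at every point extends to
a global isometry, i.e. every point is an isolated fixed point of a global isometry whose
differential there is `-id` (in chart coordinates). -/
def IsSymmetricSpace (Y : PRManifold n) : Prop :=
  ∀ q : Y.M, ∃ σ : Y.M → Y.M, Y.IsAutoIsometry σ ∧ σ q = q ∧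
    ∀ a i : Fin n,
      pd i (fun x => (Y.chartAt (σ q)).φ (σ ((Y.chartAt q).ψ x)) a) ((Y.chartAt q).φ q)
        = -(if i = a then 1 else 0)

/-- The metric of `X` is real-analytic: around every point there are coordinates in which
the metric components are real-analytic functions. -/
def AnalyticMetric (X : PRManifold n) : Prop :=
  ∀ p : X.M, ∃ S, IsOpen S ∧ (X.chartAt p).φ p ∈ S ∧ S ⊆ (X.chartAt p).ran ∧
    ∃ (τ : (Fin n → ℝ) → Fin n → ℝ) (G : MetricMat n),
      Set.InjOn τ S ∧ (∀ a b : Fin n, AnalyticOnNhd ℝ (fun y => G y a b) (τ '' S)) ∧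
      IsPullbackIsometry (X.chartAt p).g G τ S

end PRManifold

/-- `Z` is globally isometric to the direct product `X × Y` (with the product metric):
there is a bijection which, read in charts, is an isometry onto the product. -/
def GloballyIsometricToProd {n₀ n₁ n₂ : ℕ} (Z : PRManifold n₀)
    (X : PRManifold n₁) (Y : PRManifold n₂) : Prop :=
  ∃ F : Z.M → X.M × Y.M, Function.Bijective F ∧
    ∀ p : Z.M, ∃ S, IsOpen S ∧ (Z.chartAt p).φ p ∈ S ∧ S ⊆ (Z.chartAt p).ran ∧
      (∀ x ∈ S, (F ((Z.chartAt p).ψ x)).1 ∈ (X.chartAt (F p).1).dom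
        ∧ (F ((Z.chartAt p).ψ x)).2 ∈ (Y.chartAt (F p).2).dom) ∧
      IsPullbackIsometry (Z.chartAt p).g
        (prodMetricMat (X.chartAt (F p).1).g (Y.chartAt (F p).2).g)
        (fun x => Fin.append ((X.chartAt (F p).1).φ (F ((Z.chartAt p).ψ x)).1)
          ((Y.chartAt (F p).2).φ (F ((Z.chartAt p).ψ x)).2)) S

/-- `X` is globally isometric to the direct product of the coordinate spacetime
`(ℝ^{e+2}, Gcw)` and `Y` (with the product metric). -/
def GloballyIsometricToCWProd {n e m : ℕ} (X : PRManifold n) (Gcw : MetricMat (e + 2))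
    (Y : PRManifold m) : Prop :=
  ∃ F : X.M → (Fin (e + 2) → ℝ) × Y.M, Function.Bijective F ∧
    ∀ p : X.M, ∃ S, IsOpen S ∧ (X.chartAt p).φ p ∈ S ∧ S ⊆ (X.chartAt p).ran ∧
      (∀ x ∈ S, (F ((X.chartAt p).ψ x)).2 ∈ (Y.chartAt (F p).2).dom) ∧
      IsPullbackIsometry (X.chartAt p).g (prodMetricMat Gcw (Y.chartAt (F p).2).g)
        (fun x => Fin.append (F ((X.chartAt p).ψ x)).1
          ((Y.chartAt (F p).2).φ (F ((X.chartAt p).ψ x)).2)) S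

/-- `X` is locally isometric to the direct product of the coordinate spacetime
`(ℝ^{e+2}, Gcw)` and `Y`: every point has a neighbourhood that maps isometrically into
the product. -/
def LocallyIsometricToCWProd {n e m : ℕ} (X : PRManifold n) (Gcw : MetricMat (e + 2))
    (Y : PRManifold m) : Prop :=
  ∀ p : X.M, ∃ q : Y.M, ∃ S, IsOpen S ∧ (X.chartAt p).φ p ∈ S ∧ S ⊆ (X.chartAt p).ran ∧
    ∃ τ : (Fin n → ℝ) → Fin ((e + 2) + m) → ℝ,
      (∀ x ∈ S, split2 (n₁ := e + 2) (τ x) ∈ (Y.chartAt q).ran) ∧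
      IsPullbackIsometry (X.chartAt p).g (prodMetricMat Gcw (Y.chartAt q).g) τ S

/-- An identification of `Σ i, Fin (m i)` with `Fin (∑ i, m i)`. -/
def sigmaFinEquiv {k : ℕ} (m : Fin k → ℕ) : (Σ i : Fin k, Fin (m i)) ≃ Fin (∑ i, m i) :=
  (Fintype.equivFin _).trans (finCongr (by simp))

/-- The `i`-th block of coordinates in `ℝ^{∑ mdim}`. -/
def sigCoord {k : ℕ} {mdim : Fin k → ℕ} (x : Fin (∑ i, mdim i) → ℝ) (i : Fin k) :
    Fin (mdim i) → ℝ := fun a => x (sigmaFinEquiv mdim ⟨i, a⟩)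

/-- The block-diagonal metric of a finite direct product, in coordinates. -/
def multiBlockMetric {k : ℕ} {mdim : Fin k → ℕ}
    (G : (i : Fin k) → MetricMat (mdim i)) : MetricMat (∑ i, mdim i) := fun x a b =>
  let sa := (sigmaFinEquiv mdim).symm a
  let sb := (sigmaFinEquiv mdim).symm b
  if h : sa.1 = sb.1 then G sb.1 (sigCoord x sb.1) (h ▸ sa.2) sb.2 else 0

/-- `X` is globally isometric to the direct product of the coordinate spacetime
`(ℝ^d, Gcw)` with the finite family of manifolds `Y i` (with the product metric). -/
def GloballyIsometricToCWMultiProd {n d k : ℕ} {mdim : Fin k → ℕ}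
    (X : PRManifold n) (Gcw : MetricMat d)
    (Y : (i : Fin k) → PRManifold (mdim i)) : Prop :=
  ∃ F : X.M → (Fin d → ℝ) × ((i : Fin k) → (Y i).M), Function.Bijective F ∧
    ∀ p : X.M, ∃ S, IsOpen S ∧ (X.chartAt p).φ p ∈ S ∧ S ⊆ (X.chartAt p).ran ∧
      (∀ x ∈ S, ∀ i, (F ((X.chartAt p).ψ x)).2 i ∈ ((Y i).chartAt ((F p).2 i)).dom) ∧
      IsPullbackIsometry (X.chartAt p).g
        (prodMetricMat Gcw (multiBlockMetric fun i => ((Y i).chartAt ((F p).2 i)).g))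
        (fun x => Fin.append (F ((X.chartAt p).ψ x)).1
          (fun j => let s := (sigmaFinEquiv mdim).symm j
            ((Y s.1).chartAt ((F p).2 s.1)).φ ((F ((X.chartAt p).ψ x)).2 s.1) s.2)) S

/-- `X` is locally isometric to the direct product of the coordinate spacetime
`(ℝ^d, Gcw)` with the finite family of manifolds `Y i`. -/
def LocallyIsometricToCWMultiProd {n d k : ℕ} {mdim : Fin k → ℕ}
    (X : PRManifold n) (Gcw : MetricMat d)
    (Y : (i : Fin k) → PRManifold (mdim i)) : Prop :=
  ∀ p : X.M, ∃ q : (i : Fin k) → (Y i).M, ∃ S, IsOpen S ∧ (X.chartAt p).φ p ∈ S ∧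
    S ⊆ (X.chartAt p).ran ∧
    ∃ τ : (Fin n → ℝ) → Fin (d + ∑ i, mdim i) → ℝ,
      (∀ x ∈ S, ∀ i : Fin k,
        sigCoord (split2 (n₁ := d) (τ x)) i ∈ ((Y i).chartAt (q i)).ran) ∧
      IsPullbackIsometry (X.chartAt p).g
        (prodMetricMat Gcw (multiBlockMetric fun i => ((Y i).chartAt (q i)).g)) τ S

/-- `X'` (with projection `π`) is a universal covering of `X`, with the pulled-back
metric: `π` is a topological covering map, `X'` is simply connected and `π` is a local
isometry. -/
def IsUniversalCoverOf {n : ℕ} (X' X : PRManifold n) (π : X'.M → X.M) : Prop :=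
  IsCoveringMap π ∧ X'.SimplyConn ∧
    ∀ p : X'.M, ∃ S, IsOpen S ∧ (X'.chartAt p).φ p ∈ S ∧ S ⊆ (X'.chartAt p).ran ∧
      (∀ x ∈ S, π ((X'.chartAt p).ψ x) ∈ (X.chartAt (π p)).dom) ∧
      IsPullbackIsometry (X'.chartAt p).g (X.chartAt (π p)).g
        (fun x => (X.chartAt (π p)).φ (π ((X'.chartAt p).ψ x))) S

section PlaneWaveCurvature

variable {e : ℕ}

theorem hasFDerivAt_coord {n : ℕ} (i : Fin n) (x : Fin n → ℝ) :
    HasFDerivAt (fun y : Fin n → ℝ => y i) (ContinuousLinearMap.proj i : (Fin n → ℝ) →L[ℝ] ℝ) x :=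
  (ContinuousLinearMap.proj i : (Fin n → ℝ) →L[ℝ] ℝ).hasFDerivAt

/-- The quadratic form `M_{ij}(u) xⁱ xʲ` in the spatial coordinates. -/
def quadProfile (M : ℝ → Matrix (Fin e) (Fin e) ℝ) (x : Fin (e + 2) → ℝ) : ℝ :=
  ∑ i, ∑ j, M (x 0) i j * x i.succ.succ * x j.succ.succ

/-- The linear form `M_{aj}(u) xʲ` in the spatial coordinates. -/
def linProfile (M : ℝ → Matrix (Fin e) (Fin e) ℝ) (a : Fin e) (x : Fin (e + 2) → ℝ) : ℝ :=
  ∑ j, M (x 0) a j * x j.succ.succ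

/-- `M'` is the entrywise derivative of the matrix-valued function `M`. -/
def HasEntryDeriv (M M' : ℝ → Matrix (Fin e) (Fin e) ℝ) : Prop :=
  ∀ u i j, HasDerivAt (fun t => M t i j) (M' u i j) u

theorem HasEntryDeriv.hasFDerivAt {M M' : ℝ → Matrix (Fin e) (Fin e) ℝ}
    (h : HasEntryDeriv M M') (i j : Fin e) (x : Fin (e + 2) → ℝ) :
    HasFDerivAt (fun y : Fin (e + 2) → ℝ => M (y 0) i j)
      (M' (x 0) i j • (ContinuousLinearMap.proj 0 : (Fin (e + 2) → ℝ) →L[ℝ] ℝ)) x :=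
  HasDerivAt.comp_hasFDerivAt (h₂ := fun t => M t i j) x (h (x 0) i j) (hasFDerivAt_coord 0 x)

theorem hasFDerivAt_linProfile {M M' : ℝ → Matrix (Fin e) (Fin e) ℝ}
    (h : HasEntryDeriv M M') (a : Fin e) (x : Fin (e + 2) → ℝ) :
    HasFDerivAt (linProfile M a)
      (∑ j : Fin e, (M (x 0) a j • (ContinuousLinearMap.proj j.succ.succ :
          (Fin (e + 2) → ℝ) →L[ℝ] ℝ) +
        x j.succ.succ • M' (x 0) a j • (ContinuousLinearMap.proj 0 :
          (Fin (e + 2) → ℝ) →L[ℝ] ℝ))) x := by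
  refine HasFDerivAt.fun_sum fun j _ => ?_
  exact (h.hasFDerivAt a j x).mul (hasFDerivAt_coord j.succ.succ x)

theorem hasFDerivAt_quadProfile {M M' : ℝ → Matrix (Fin e) (Fin e) ℝ}
    (h : HasEntryDeriv M M') (x : Fin (e + 2) → ℝ) :
    HasFDerivAt (quadProfile M)
      (∑ i : Fin e, ∑ j : Fin e,
        ((M (x 0) i j * x i.succ.succ) • (ContinuousLinearMap.proj j.succ.succ :
          (Fin (e + 2) → ℝ) →L[ℝ] ℝ) +
        x j.succ.succ • (M (x 0) i j • (ContinuousLinearMap.proj i.succ.succ :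
          (Fin (e + 2) → ℝ) →L[ℝ] ℝ) +
        x i.succ.succ • M' (x 0) i j • (ContinuousLinearMap.proj 0 :
          (Fin (e + 2) → ℝ) →L[ℝ] ℝ)))) x := by
  refine HasFDerivAt.fun_sum fun i _ => HasFDerivAt.fun_sum fun j _ => ?_
  exact ((h.hasFDerivAt i j x).mul (hasFDerivAt_coord i.succ.succ x)).mul
    (hasFDerivAt_coord j.succ.succ x)

section PartialDerivatives

variable {M M' : ℝ → Matrix (Fin e) (Fin e) ℝ}

theorem pd_const {n : ℕ} (i : Fin n) (c : ℝ) (x : Fin n → ℝ) : pd i (fun _ => c) x = 0 := by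
  simp [pd]

theorem pd_linProfile_zero (h : HasEntryDeriv M M') (a : Fin e) (x : Fin (e + 2) → ℝ) :
    pd 0 (linProfile M a) x = linProfile M' a x := by
  rw [pd, (hasFDerivAt_linProfile h a x).fderiv]
  simp [linProfile, mul_comm]

theorem pd_linProfile_one (h : HasEntryDeriv M M') (a : Fin e) (x : Fin (e + 2) → ℝ) :
    pd 1 (linProfile M a) x = 0 := by
  rw [pd, (hasFDerivAt_linProfile h a x).fderiv]
  simp [Fin.ext_iff]

theorem pd_linProfile_succ_succ (h : HasEntryDeriv M M') (a b : Fin e) (x : Fin (e + 2) → ℝ) :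
    pd b.succ.succ (linProfile M a) x = M (x 0) a b := by
  rw [pd, (hasFDerivAt_linProfile h a x).fderiv]
  simp [Pi.single_apply]

theorem pd_quadProfile_zero (h : HasEntryDeriv M M') (x : Fin (e + 2) → ℝ) :
    pd 0 (quadProfile M) x = quadProfile M' x := by
  rw [pd, (hasFDerivAt_quadProfile h x).fderiv]
  simp only [quadProfile, _root_.sum_apply]
  refine Finset.sum_congr rfl fun i _ => Finset.sum_congr rfl fun j _ => ?_
  simp
  ring

theorem pd_quadProfile_one (h : HasEntryDeriv M M') (x : Fin (e + 2) → ℝ) :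
    pd 1 (quadProfile M) x = 0 := by
  rw [pd, (hasFDerivAt_quadProfile h x).fderiv]
  simp [Fin.ext_iff]

theorem pd_quadProfile_succ_succ (h : HasEntryDeriv M M') (hM : ∀ u, (M u).IsSymm)
    (a : Fin e) (x : Fin (e + 2) → ℝ) :
    pd a.succ.succ (quadProfile M) x = 2 * linProfile M a x := by
  rw [pd, (hasFDerivAt_quadProfile h x).fderiv]
  simp only [linProfile, _root_.sum_apply]
  simp [Pi.single_apply, Finset.sum_add_distrib, two_mul, mul_comm]
  exact Finset.sum_congr rfl fun j _ => by rw [(hM (x 0)).apply]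

end PartialDerivatives

theorem pd_const_mul {n : ℕ} (i : Fin n) (c : ℝ) (f : (Fin n → ℝ) → ℝ) (x : Fin n → ℝ) :
    pd i (fun y => c * f y) x = c * pd i f x := by
  have h : fderiv ℝ (fun y => c * f y) x = c • fderiv ℝ f x :=
    congrFun (fderiv_const_smul_field (f := f) c) x
  simp [pd, h]

theorem succ_eq_one_iff (k : Fin (e + 1)) : k.succ = 1 ↔ k = 0 :=
  Fin.succ_inj (b := 0)

theorem fin_eq_zero_or_one_or_succ_succ (i : Fin (e + 2)) :
    i = 0 ∨ i = 1 ∨ ∃ a : Fin e, i = a.succ.succ := by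
  refine Fin.cases (Or.inl rfl) (fun i => ?_) i
  exact Fin.cases (Or.inr (Or.inl rfl)) (fun a => Or.inr (Or.inr ⟨a, rfl⟩)) i

theorem succ_succ_ne_one (a : Fin e) : a.succ.succ ≠ 1 := by
  simp [succ_eq_one_iff]

theorem cwMetric_zero_zero (M : ℝ → Matrix (Fin e) (Fin e) ℝ) (x : Fin (e + 2) → ℝ) :
    cwMetric e M x 0 0 = -2 * quadProfile M x := by
  simp [cwMetric, quadProfile]

theorem cwMetric_zero_succ (M : ℝ → Matrix (Fin e) (Fin e) ℝ) (x : Fin (e + 2) → ℝ)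
    (l : Fin (e + 1)) : cwMetric e M x 0 l.succ = if l = 0 then -1 else 0 := by
  simp [cwMetric, succ_eq_one_iff, (Fin.succ_ne_zero _).symm]

theorem cwMetric_succ_zero (M : ℝ → Matrix (Fin e) (Fin e) ℝ) (x : Fin (e + 2) → ℝ)
    (k : Fin (e + 1)) : cwMetric e M x k.succ 0 = if k = 0 then -1 else 0 := by
  simp [cwMetric, succ_eq_one_iff]

theorem cwMetric_succ_succ (M : ℝ → Matrix (Fin e) (Fin e) ℝ) (x : Fin (e + 2) → ℝ)
    (k l : Fin (e + 1)) :
    cwMetric e M x k.succ l.succ = if k = l ∧ k ≠ 0 then 1 else 0 := by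
  rcases eq_or_ne k 0 with rfl | hk
  · simp [cwMetric]
  · have : 1 ≤ (k : ℕ) := Fin.pos_iff_ne_zero.2 hk
    simp [cwMetric, hk, this, Fin.succ_ne_zero]

theorem cwMetric_zero_one (M : ℝ → Matrix (Fin e) (Fin e) ℝ) (x : Fin (e + 2) → ℝ) :
    cwMetric e M x 0 1 = -1 := by
  simp [cwMetric]

theorem cwMetric_one_zero (M : ℝ → Matrix (Fin e) (Fin e) ℝ) (x : Fin (e + 2) → ℝ) :
    cwMetric e M x 1 0 = -1 := by
  simp [cwMetric]

theorem cwMetric_one_succ (M : ℝ → Matrix (Fin e) (Fin e) ℝ) (x : Fin (e + 2) → ℝ)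
    (l : Fin (e + 1)) : cwMetric e M x 1 l.succ = 0 := by
  simpa using cwMetric_succ_succ M x 0 l

theorem cwMetric_one_one (M : ℝ → Matrix (Fin e) (Fin e) ℝ) (x : Fin (e + 2) → ℝ) :
    cwMetric e M x 1 1 = 0 := by
  simp [cwMetric]

theorem cwMetric_succ_one (M : ℝ → Matrix (Fin e) (Fin e) ℝ) (x : Fin (e + 2) → ℝ)
    (k : Fin (e + 1)) : cwMetric e M x k.succ 1 = 0 := by
  rw [← Fin.succ_zero_eq_one, cwMetric_succ_succ, if_neg fun h => h.2 h.1]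

/-- The inverse of the plane-wave metric. -/
def cwMetricInv (M : ℝ → Matrix (Fin e) (Fin e) ℝ) : MetricMat (e + 2) := fun x =>
  Fin.cons (Fin.cons 0 (Fin.cons (-1) 0))
    (Fin.cons (Fin.cons (-1) (Fin.cons (2 * quadProfile M x) 0))
      fun a => Fin.cons 0 (Fin.cons 0 (Pi.single a 1)))

theorem cwMetric_inv (M : ℝ → Matrix (Fin e) (Fin e) ℝ) (x : Fin (e + 2) → ℝ) :
    (cwMetric e M x)⁻¹ = cwMetricInv M x := by
  apply Matrix.inv_eq_right_inv
  ext k l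
  rw [Matrix.mul_apply, Fin.sum_univ_succ, Fin.sum_univ_succ]
  have h0 (a : Fin e) : (0 : Fin (e + 2)) ≠ a.succ.succ := (Fin.succ_ne_zero _).symm
  have h1 (a : Fin e) : (1 : Fin (e + 2)) ≠ a.succ.succ := (succ_succ_ne_one a).symm
  rcases fin_eq_zero_or_one_or_succ_succ k with rfl | rfl | ⟨k, rfl⟩ <;>
  rcases fin_eq_zero_or_one_or_succ_succ l with rfl | rfl | ⟨l, rfl⟩ <;>
  simp [cwMetric_zero_zero, cwMetric_zero_one, cwMetric_one_zero, cwMetric_one_one,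
    cwMetric_one_succ, cwMetric_succ_one, cwMetric_succ_zero, cwMetric_succ_succ, cwMetricInv,
    cwMetric_zero_succ,
    Matrix.one_apply, Pi.single_apply, h0, h1, succ_succ_ne_one, eq_comm]

/-- Partial derivative of the only nonconstant metric component. -/
theorem pd_cwMetric (M : ℝ → Matrix (Fin e) (Fin e) ℝ) (x : Fin (e + 2) → ℝ)
    (i k l : Fin (e + 2)) :
    pd i (fun y => cwMetric e M y k l) x =
      if k = 0 ∧ l = 0 then -2 * pd i (quadProfile M) x else 0 := by
  refine Fin.cases ?_ (fun k => ?_) k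
  all_goals refine Fin.cases ?_ (fun l => ?_) l
  all_goals simp only [cwMetric_zero_zero, cwMetric_zero_succ, cwMetric_succ_zero,
    cwMetric_succ_succ, pd_const, pd_const_mul]
  all_goals simp

theorem christoffel_cwMetric_zero {M M' : ℝ → Matrix (Fin e) (Fin e) ℝ} (h : HasEntryDeriv M M')
    (x : Fin (e + 2) → ℝ) (i j : Fin (e + 2)) :
    christoffel (cwMetric e M) x 0 i j = 0 := by
  simp [christoffel, cwMetric_inv, pd_cwMetric, Fin.sum_univ_succ, cwMetricInv,
    pd_quadProfile_one h]

theorem christoffel_cwMetric_one {M M' : ℝ → Matrix (Fin e) (Fin e) ℝ} (h : HasEntryDeriv M M')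
    (x : Fin (e + 2) → ℝ) (i j : Fin (e + 2)) :
    christoffel (cwMetric e M) x 1 i j =
      (if j = 0 then pd i (quadProfile M) x else 0) + (if i = 0 then pd j (quadProfile M) x else 0)
      - (if i = 0 ∧ j = 0 then pd 0 (quadProfile M) x else 0) := by
  simp [christoffel, cwMetric_inv, pd_cwMetric, Fin.sum_univ_succ, cwMetricInv,
    pd_quadProfile_one h]
  split_ifs <;> simp_all

theorem christoffel_cwMetric_succ_succ {M M' : ℝ → Matrix (Fin e) (Fin e) ℝ}
    (h : HasEntryDeriv M M') (hM : ∀ u, (M u).IsSymm)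
    (x : Fin (e + 2) → ℝ) (a : Fin e) (i j : Fin (e + 2)) :
    christoffel (cwMetric e M) x a.succ.succ i j =
      if i = 0 ∧ j = 0 then 2 * linProfile M a x else 0 := by
  simp [christoffel, cwMetric_inv, pd_cwMetric, Fin.sum_univ_succ, cwMetricInv,
    pd_quadProfile_succ_succ h hM, Pi.single_apply]
  split_ifs <;> ring

/-- Extension of a spatial matrix by zero to a bilinear form on `ℝ^{e+2}`. -/
def spatialExt (A : Matrix (Fin e) (Fin e) ℝ) (k l : Fin (e + 2)) : ℝ :=
  ∑ a, ∑ b, if k = a.succ.succ ∧ l = b.succ.succ then A a b else 0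

theorem spatialExt_zero_left (A : Matrix (Fin e) (Fin e) ℝ) (l : Fin (e + 2)) :
    spatialExt A 0 l = 0 := by
  simp [spatialExt, (Fin.succ_ne_zero _).symm]

theorem spatialExt_zero_right (A : Matrix (Fin e) (Fin e) ℝ) (k : Fin (e + 2)) :
    spatialExt A k 0 = 0 := by
  simp [spatialExt, (Fin.succ_ne_zero _).symm]

theorem spatialExt_one_left (A : Matrix (Fin e) (Fin e) ℝ) (l : Fin (e + 2)) :
    spatialExt A 1 l = 0 := by
  simp [spatialExt, (succ_succ_ne_one _).symm]

theorem spatialExt_one_right (A : Matrix (Fin e) (Fin e) ℝ) (k : Fin (e + 2)) :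
    spatialExt A k 1 = 0 := by
  simp [spatialExt, (succ_succ_ne_one _).symm]

theorem spatialExt_succ_succ (A : Matrix (Fin e) (Fin e) ℝ) (a b : Fin e) :
    spatialExt A a.succ.succ b.succ.succ = A a b := by
  simp [spatialExt, ite_and]

section Curvature

variable {M M' M'' : ℝ → Matrix (Fin e) (Fin e) ℝ}

theorem curvUp_cwMetric_zero (h : HasEntryDeriv M M') (x : Fin (e + 2) → ℝ)
    (k i j : Fin (e + 2)) : curvUp (cwMetric e M) x 0 k i j = 0 := by
  simp [curvUp, christoffel_cwMetric_zero h, pd_const]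

theorem curvUp_cwMetric_succ_succ (h : HasEntryDeriv M M') (hM : ∀ u, (M u).IsSymm)
    (x : Fin (e + 2) → ℝ) (a : Fin e) (k i j : Fin (e + 2)) :
    curvUp (cwMetric e M) x a.succ.succ k i j =
      2 * ((if k = 0 ∧ j = 0 then spatialExt (M (x 0)) a.succ.succ i else 0)
        - if k = 0 ∧ i = 0 then spatialExt (M (x 0)) a.succ.succ j else 0) := by
  have h0 (a : Fin e) : (0 : Fin (e + 2)) ≠ a.succ.succ := (Fin.succ_ne_zero _).symm
  rcases fin_eq_zero_or_one_or_succ_succ k with rfl | rfl | ⟨k, rfl⟩ <;>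
  rcases fin_eq_zero_or_one_or_succ_succ i with rfl | rfl | ⟨i, rfl⟩ <;>
  rcases fin_eq_zero_or_one_or_succ_succ j with rfl | rfl | ⟨j, rfl⟩ <;>
  simp [curvUp, christoffel_cwMetric_zero h, christoffel_cwMetric_succ_succ h hM, pd_const,
    pd_const_mul, pd_linProfile_one h, pd_linProfile_succ_succ h, pd_linProfile_zero h,
    spatialExt_zero_right, spatialExt_one_right,
    spatialExt_succ_succ]

theorem curvUp_cwMetric_one (h : HasEntryDeriv M M') (h' : HasEntryDeriv M' M'')
    (hM : ∀ u, (M u).IsSymm) (hM' : ∀ u, (M' u).IsSymm)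
    (x : Fin (e + 2) → ℝ) (k i j : Fin (e + 2)) :
    curvUp (cwMetric e M) x 1 k i j =
      2 * ((if j = 0 then spatialExt (M (x 0)) k i else 0)
        - if i = 0 then spatialExt (M (x 0)) k j else 0) := by
  have h0 (a : Fin e) : (0 : Fin (e + 2)) ≠ a.succ.succ := (Fin.succ_ne_zero _).symm
  rcases fin_eq_zero_or_one_or_succ_succ k with rfl | rfl | ⟨k, rfl⟩ <;>
  rcases fin_eq_zero_or_one_or_succ_succ i with rfl | rfl | ⟨i, rfl⟩ <;>
  rcases fin_eq_zero_or_one_or_succ_succ j with rfl | rfl | ⟨j, rfl⟩ <;>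
  simp [curvUp, christoffel_cwMetric_zero h, christoffel_cwMetric_one h,
    christoffel_cwMetric_succ_succ h hM, pd_const, Fin.sum_univ_succ, pd_const_mul,
    pd_linProfile_one h, pd_linProfile_succ_succ h, pd_linProfile_zero h,
    pd_quadProfile_zero h, pd_quadProfile_one h, pd_quadProfile_succ_succ h hM,
    pd_quadProfile_zero h', pd_quadProfile_one h', pd_quadProfile_succ_succ h' hM',
    spatialExt_zero_left, spatialExt_zero_right, spatialExt_one_left, spatialExt_one_right,
    spatialExt_succ_succ]
  rw [(hM (x 0)).apply, sub_self]

/-- The Kulkarni–Nomizu type tensor built from a spatial matrix and `du ⊗ du`. -/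
def curvModel (A : Matrix (Fin e) (Fin e) ℝ) (idx : Fin 4 → Fin (e + 2)) : ℝ :=
  2 * ((if idx 1 = 0 ∧ idx 3 = 0 then spatialExt A (idx 0) (idx 2) else 0)
    - (if idx 1 = 0 ∧ idx 2 = 0 then spatialExt A (idx 0) (idx 3) else 0)
    - (if idx 0 = 0 ∧ idx 3 = 0 then spatialExt A (idx 1) (idx 2) else 0)
    + (if idx 0 = 0 ∧ idx 2 = 0 then spatialExt A (idx 1) (idx 3) else 0))

theorem riemann_cwMetric (h : HasEntryDeriv M M') (h' : HasEntryDeriv M' M'')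
    (hM : ∀ u, (M u).IsSymm) (hM' : ∀ u, (M' u).IsSymm)
    (x : Fin (e + 2) → ℝ) (idx : Fin 4 → Fin (e + 2)) :
    riemann (cwMetric e M) x idx = curvModel (M (x 0)) idx := by
  rw [riemann, Fin.sum_univ_succ, Fin.sum_univ_succ, curvModel]
  generalize idx 0 = l
  rcases fin_eq_zero_or_one_or_succ_succ l with rfl | rfl | ⟨l, rfl⟩ <;>
  simp [curvUp_cwMetric_zero h, curvUp_cwMetric_one h h' hM hM',
    curvUp_cwMetric_succ_succ h hM, spatialExt_zero_left, spatialExt_one_left,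
    cwMetric_zero_succ, cwMetric_zero_one, cwMetric_one_one, cwMetric_one_succ, cwMetric_succ_zero,
    cwMetric_succ_succ, cwMetric_succ_one]
  ring

end Curvature

/-- `du^{⊗ r} ⊗ curvModel A`, the shape of `∇ʳR` for a plane wave. -/
def covModel (A : Matrix (Fin e) (Fin e) ℝ) : (r : ℕ) → (Fin (4 + r) → Fin (e + 2)) → ℝ
  | 0 => curvModel A
  | r + 1 => fun idx => if idx 0 = 0 then covModel A r fun a => idx a.succ else 0

theorem curvModel_eq_zero_of_one (A : Matrix (Fin e) (Fin e) ℝ) (idx : Fin 4 → Fin (e + 2))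
    (a : Fin 4) (ha : idx a = 1) : curvModel A idx = 0 := by
  fin_cases a <;> simp at ha <;>
    simp [curvModel, ha, spatialExt_one_left, spatialExt_one_right]

theorem covModel_eq_zero_of_one (A : Matrix (Fin e) (Fin e) ℝ) (r : ℕ)
    (idx : Fin (4 + r) → Fin (e + 2)) (a : Fin (4 + r)) (ha : idx a = 1) :
    covModel A r idx = 0 := by
  induction r with
  | zero => exact curvModel_eq_zero_of_one A idx a ha
  | succ r ih =>
    rw [covModel, ite_eq_right_iff]
    intro h0
    revert ha
    refine Fin.cases (fun ha => ?_) (fun a ha => ?_) a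
    · simp [h0] at ha
    · exact ih _ a ha

/-- Infinitesimal invariance of `curvModel A` under null rotations fixing `du`. -/
theorem sum_curvModel_update (A : Matrix (Fin e) (Fin e) ℝ) (c : Fin e)
    (idx : Fin 4 → Fin (e + 2)) :
    ∑ a, (if idx a = 0 then curvModel A (Function.update idx a c.succ.succ) else 0) = 0 := by
  by_cases h0 : idx 0 = 0 <;> by_cases h1 : idx 1 = 0 <;> by_cases h2 : idx 2 = 0 <;>
    by_cases h3 : idx 3 = 0 <;>
    simp [Fin.sum_univ_four, curvModel, Function.update, h0, h1, h2, h3,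
      spatialExt_zero_left, spatialExt_zero_right]

theorem sum_covModel_update (A : Matrix (Fin e) (Fin e) ℝ) (c : Fin e) (r : ℕ)
    (idx : Fin (4 + r) → Fin (e + 2)) :
    ∑ a, (if idx a = 0 then covModel A r (Function.update idx a c.succ.succ) else 0) = 0 := by
  induction r with
  | zero => exact sum_curvModel_update A c idx
  | succ r ih =>
    have htail (a : Fin (4 + r)) :
        (fun b : Fin (4 + r) => Function.update idx a.succ c.succ.succ b.succ) =
          Function.update (fun b : Fin (4 + r) => idx b.succ) a c.succ.succ := by
      ext b
      simp [Function.update_apply]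
    refine (Fin.sum_univ_succ (n := 4 + r) _).trans ?_
    by_cases h0 : idx 0 = 0
    · simpa [covModel, h0, htail, (Fin.succ_ne_zero _).symm] using ih fun b => idx b.succ
    · simp [covModel, h0, (Fin.succ_ne_zero _).symm]

theorem HasEntryDeriv.spatialExt {M M' : ℝ → Matrix (Fin e) (Fin e) ℝ} (h : HasEntryDeriv M M')
    (u : ℝ) (k l : Fin (e + 2)) :
    HasDerivAt (fun t => spatialExt (M t) k l) (spatialExt (M' u) k l) u := by
  refine HasDerivAt.fun_sum fun a _ => HasDerivAt.fun_sum fun b _ => ?_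
  split_ifs
  · exact h u a b
  · exact hasDerivAt_const u 0

theorem HasEntryDeriv.covModel {M M' : ℝ → Matrix (Fin e) (Fin e) ℝ} (h : HasEntryDeriv M M')
    (u : ℝ) (r : ℕ) (idx : Fin (4 + r) → Fin (e + 2)) :
    HasDerivAt (fun t => covModel (M t) r idx) (covModel (M' u) r idx) u := by
  have hite (p : Prop) [Decidable p] (k l : Fin (e + 2)) :
      HasDerivAt (fun t => if p then _root_.spatialExt (M t) k l else 0)
        (if p then _root_.spatialExt (M' u) k l else 0) u := by
    split_ifs
    · exact h.spatialExt u k l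
    · exact hasDerivAt_const u 0
  induction r with
  | zero =>
    exact ((((hite _ _ _).sub (hite _ _ _)).sub (hite _ _ _)).add (hite _ _ _)).const_mul 2
  | succ r ih =>
    simp only [_root_.covModel]
    split_ifs
    · exact ih _
    · exact hasDerivAt_const u 0

theorem covModel_zero (r : ℕ) (idx : Fin (4 + r) → Fin (e + 2)) : covModel 0 r idx = 0 := by
  induction r with
  | zero => simp [covModel, curvModel, spatialExt]
  | succ r ih => simp [covModel, ih]

theorem exists_covModel_eq (A : Matrix (Fin e) (Fin e) ℝ) (a b : Fin e) (r : ℕ) :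
    ∃ idx, covModel A r idx = 2 * A a b := by
  induction r with
  | zero =>
    refine ⟨![a.succ.succ, 0, b.succ.succ, 0], ?_⟩
    simp [covModel, curvModel, spatialExt_succ_succ]
  | succ r ih =>
    obtain ⟨idx, hidx⟩ := ih
    exact ⟨Fin.cons (α := fun _ => Fin (e + 2)) 0 idx, by simpa [covModel] using hidx⟩

theorem pd_comp_coord_zero {f : ℝ → ℝ} {f' : ℝ} {x : Fin (e + 2) → ℝ}
    (h : HasDerivAt f f' (x 0)) (i : Fin (e + 2)) :
    pd i (fun y => f (y 0)) x = if i = 0 then f' else 0 := by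
  have := h.comp_hasFDerivAt x (hasFDerivAt_coord 0 x)
  simp only [Function.comp_def] at this
  rw [pd, this.fderiv]
  simp [Pi.single_apply, eq_comm]

theorem covDeriv_covModel {M M' N N' : ℝ → Matrix (Fin e) (Fin e) ℝ}
    (hM : HasEntryDeriv M M') (hsymm : ∀ u, (M u).IsSymm) (hN : HasEntryDeriv N N')
    (r : ℕ) (x : Fin (e + 2) → ℝ) (idx : Fin (4 + r + 1) → Fin (e + 2)) :
    covDeriv (cwMetric e M) (fun y => covModel (N (y 0)) r) x idx =
      covModel (N' (x 0)) (r + 1) idx := by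
  have hpd := pd_comp_coord_zero (hN.covModel (x 0) r fun a => idx a.succ) (idx 0)
  have hsum (a : Fin (4 + r)) :
      ∑ m, christoffel (cwMetric e M) x m (idx 0) (idx a.succ) *
        covModel (N (x 0)) r (Function.update (fun b : Fin (4 + r) => idx b.succ) a m) =
      ∑ c : Fin e, (if idx 0 = 0 then 2 * linProfile M c x else 0) *
        (if idx a.succ = 0 then covModel (N (x 0)) r
          (Function.update (fun b : Fin (4 + r) => idx b.succ) a c.succ.succ) else 0) := by
    rw [Fin.sum_univ_succ, Fin.sum_univ_succ, christoffel_cwMetric_zero hM,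
      Fin.succ_zero_eq_one, covModel_eq_zero_of_one _ r _ a (Function.update_self ..),
      zero_mul, mul_zero, zero_add, zero_add]
    refine Finset.sum_congr rfl fun c _ => ?_
    rw [christoffel_cwMetric_succ_succ hM hsymm]
    split_ifs <;> simp_all
  simp only [covDeriv, hsum]
  rw [hpd, Finset.sum_comm]
  simp only [← Finset.mul_sum]
  rw [Finset.sum_eq_zero fun c _ => by
    rw [sum_covModel_update _ c r fun b => idx b.succ, mul_zero], sub_zero]
  rfl

/-- For a plane wave, `∇ʳR` is `du^{⊗ r}` times the curvature built from the `r`-th derivative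
of the profile. -/
theorem nablaR_cwMetric {Q : ℕ → ℝ → Matrix (Fin e) (Fin e) ℝ}
    (hQ : ∀ k, HasEntryDeriv (Q k) (Q (k + 1))) (hsymm : ∀ k u, (Q k u).IsSymm)
    (r : ℕ) (x : Fin (e + 2) → ℝ) (idx : Fin (4 + r) → Fin (e + 2)) :
    nablaR (cwMetric e (Q 0)) r x idx = covModel (Q r (x 0)) r idx := by
  induction r generalizing x with
  | zero => exact riemann_cwMetric (hQ 0) (hQ 1) (hsymm 0) (hsymm 1) x idx
  | succ r ih =>
    have hT : nablaR (cwMetric e (Q 0)) r = fun y => covModel (Q r (y 0)) r :=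
      funext fun y => funext fun idx => ih y idx
    rw [nablaR, hT]
    exact covDeriv_covModel (hQ 0) (hsymm 0) (hQ r) r x idx

/-- The `k`-th derivative of the matrix polynomial `∑ uˡ C_l`. -/
def polyDeriv {r : ℕ} (C : Fin r → Matrix (Fin e) (Fin e) ℝ) (k : ℕ) (u : ℝ) :
    Matrix (Fin e) (Fin e) ℝ :=
  ∑ l : Fin r, (((l : ℕ).descFactorial k : ℝ) * u ^ ((l : ℕ) - k)) • C l

theorem polyDeriv_zero {r : ℕ} (C : Fin r → Matrix (Fin e) (Fin e) ℝ) :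
    polyDeriv C 0 = fun u => ∑ l : Fin r, u ^ (l : ℕ) • C l := by
  ext u
  simp [polyDeriv]

theorem hasEntryDeriv_polyDeriv {r : ℕ} (C : Fin r → Matrix (Fin e) (Fin e) ℝ) (k : ℕ) :
    HasEntryDeriv (polyDeriv C k) (polyDeriv C (k + 1)) := by
  intro u i j
  simp only [polyDeriv, Matrix.sum_apply, Matrix.smul_apply, smul_eq_mul]
  refine HasDerivAt.fun_sum fun l _ => ?_
  refine (((hasDerivAt_pow ((l : ℕ) - k) u).const_mul ((l : ℕ).descFactorial k : ℝ)).mul_const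
    (C l i j)).congr_deriv ?_
  rw [Nat.descFactorial_succ, Nat.sub_sub]
  push_cast
  ring

theorem polyDeriv_isSymm {r : ℕ} {C : Fin r → Matrix (Fin e) (Fin e) ℝ}
    (hC : ∀ l, (C l).IsSymm) (k : ℕ) (u : ℝ) : (polyDeriv C k u).IsSymm := by
  ext i j
  simp [polyDeriv, Matrix.sum_apply, (hC _).apply]

theorem polyDeriv_eq_zero {r : ℕ} (C : Fin r → Matrix (Fin e) (Fin e) ℝ) (u : ℝ) :
    polyDeriv C r u = 0 :=
  Finset.sum_eq_zero fun l _ => by simp [Nat.descFactorial_of_lt l.2]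

theorem polyDeriv_pred {r : ℕ} (hr : r - 1 < r) (C : Fin r → Matrix (Fin e) (Fin e) ℝ) (u : ℝ) :
    polyDeriv C (r - 1) u = ((r - 1).factorial : ℝ) • C ⟨r - 1, hr⟩ := by
  rw [polyDeriv, Finset.sum_eq_single ⟨r - 1, hr⟩]
  · simp [Nat.descFactorial_self]
  · intro l _ hl
    have : (l : ℕ) < r - 1 := by
      have := Fin.val_ne_iff.2 hl
      simp only at this
      omega
    simp [Nat.descFactorial_of_lt this]
  · simp

end PlaneWaveCurvature

/-!
## STATEMENT 8
Every generalized Cahen–Wallach spacetime `CW^d_r(A)` of order `r` (here with `d = e+2`,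
`e ≥ 1`, and `A(u) = ∑_{l<r} uˡ • A^{(l)}` a symmetric matrix polynomial with
`A^{(r-1)} ≠ 0`) is a proper `r`-th symmetric Lorentzian manifold: `∇ʳR = 0` and
`∇^{r-1}R ≠ 0`.
-/
theorem cw_is_proper_rth_symmetric
    (e r : ℕ) (he : 1 ≤ e) (hr : 0 < r)
    (C : Fin r → Matrix (Fin e) (Fin e) ℝ)
    (hCsym : ∀ l, (C l).IsSymm)
    (hCtop : C ⟨r - 1, by omega⟩ ≠ 0) :
    RthSymmetricOn (cwMetric e fun u => ∑ l : Fin r, u ^ (l : ℕ) • C l) Set.univ r ∧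
    ¬ RthSymmetricOn (cwMetric e fun u => ∑ l : Fin r, u ^ (l : ℕ) • C l) Set.univ
        (r - 1) := by
  rw [← polyDeriv_zero]
  have hnabla := nablaR_cwMetric (hasEntryDeriv_polyDeriv C) (polyDeriv_isSymm hCsym)
  refine ⟨fun x _ idx => ?_, fun hzero => hCtop ?_⟩
  · rw [hnabla, polyDeriv_eq_zero, covModel_zero]
  · ext a b
    obtain ⟨idx, hidx⟩ := exists_covModel_eq (polyDeriv C (r - 1) 0) a b (r - 1)
    have hab := hzero 0 (Set.mem_univ _) idx
    rw [hnabla, Pi.zero_apply, hidx, polyDeriv_pred (by omega)] at hab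
    simpa [Nat.factorial_ne_zero] using hab
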